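/- arXiv:2008.01618 — 2 statements merged into one kernel-verified Lean document; each statement's English description precedes it below -/
import Mathlib

section
/- Let a := max{vmin*, c} and let F* be the cdf given by F*(v) = 0 for v < a, F*(v) = (v̄ − m)/(v̄ − a) for a ≤ v < v̄, and F*(v) = 1 for v ≥ v̄ (the two-point distribution on {a, v̄} with mean m). Then F* ∈ Δ₁(m,v̄) and R(F*,c) ≤ R(F,c) for every F ∈ Δ₁(m,v̄); that is, F* is a worst-case distribution when the reserve price equals the seller's valuation c. -/
open MeasureTheory Set Filter

/-- Expected revenue of a second-price auction with `n` bidders, seller's valuation `c`,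
value cdf `F` and reserve price `r`. -/
noncomputable def revenue (n : ℕ) (c : ℝ) (F : ℝ → ℝ) (r : ℝ) : ℝ :=
  r - (r - c) * F r ^ n +
    ∫ v in Set.Ioi r, (1 - (n : ℝ) * F v ^ (n - 1) + ((n : ℝ) - 1) * F v ^ n)

/-- The set of cdfs with support in `[0, vbar]` and mean `m`. -/
def Delta1 (m vbar : ℝ) (F : ℝ → ℝ) : Prop :=
  Monotone F ∧ (∀ x, ContinuousWithinAt F (Set.Ici x) x) ∧
    (∀ v < 0, F v = 0) ∧ (∀ v ≥ vbar, F v = 1) ∧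
    (∫ v in (0:ℝ)..vbar, (1 - F v)) = m

/-- The lowest point `vmin*` of the support of the worst-case distribution. -/
noncomputable def vminStar (n : ℕ) (m vbar : ℝ) : ℝ :=
  if n = 2 then 0 else max (m - (vbar - m) / (((n : ℝ) - 1) ^ 2 - 1)) 0

lemma one_sub_mul_pow_add_mul_pow_nonneg {x : ℝ} (hx : 0 ≤ x) (k : ℕ) :
    0 ≤ (k : ℝ) * x ^ (k + 1) - (k + 1) * x ^ k + 1 := by
  induction k with
  | zero => simp
  | succ k ih =>
    have h : 0 ≤ (x - 1) * (x ^ (k + 1) - 1) := by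
      rcases le_total 1 x with h1 | h1
      · exact mul_nonneg (sub_nonneg.2 h1) (sub_nonneg.2 (one_le_pow₀ h1))
      · exact mul_nonneg_of_nonpos_of_nonpos (sub_nonpos.2 h1)
          (sub_nonpos.2 (pow_le_one₀ hx h1))
    have h' := mul_nonneg hx ih
    push_cast
    simp only [pow_succ] at *
    linarith

/-- The revenue integrand `1 - n t ^ (n - 1) + (n - 1) t ^ n`, with `n = k + 2`, lies above its
tangent line at `t` as soon as `t ≥ 1 - 1 / (n - 1) ^ 2`. -/
lemma tangent_le_revenue_integrand (k : ℕ) {s t : ℝ} (hs : 0 ≤ s) (ht : 0 < t)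
    (hkt : ((k : ℝ) + 1) ^ 2 - 1 ≤ ((k : ℝ) + 1) ^ 2 * t) :
    1 - ((k : ℝ) + 2) * t ^ (k + 1) + (k + 1) * t ^ (k + 2)
        - (k + 2) * (k + 1) * t ^ k * (1 - t) * (s - t) ≤
      1 - ((k : ℝ) + 2) * s ^ (k + 1) + (k + 1) * s ^ (k + 2) := by
  obtain ⟨x, hx, rfl⟩ : ∃ x : ℝ, 0 ≤ x ∧ s = x * t :=
    ⟨s / t, div_nonneg hs ht.le, (div_mul_cancel₀ s ht.ne').symm⟩
  have hk : (0 : ℝ) ≤ k := k.cast_nonneg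
  have hP := mul_nonneg hx (one_sub_mul_pow_add_mul_pow_nonneg hx k)
  have hB : 0 ≤ x ^ (k + 2) - 1 - (k + 2) * (x - 1) := by
    have h := one_add_mul_le_pow (a := x - 1) (by linarith) (k + 2)
    rw [add_sub_cancel] at h
    push_cast at h
    linarith
  have hlin : 0 ≤ ((k : ℝ) + 1) * (-((k : ℝ) + 2) * x ^ (k + 1) + (k + 1) * t * x ^ (k + 2)
      + (k + 2) - (k + 1) * t + (k + 2) * (k + 1) * (1 - t) * (x - 1)) := by
    have h1 := mul_nonneg (sub_nonneg.2 hkt) hB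
    have h2 := mul_nonneg (by positivity : (0 : ℝ) ≤ k + 2) hP
    simp only [pow_succ] at *
    linarith
  have hlin' := mul_nonneg (nonneg_of_mul_nonneg_right hlin (by positivity))
    (pow_pos ht (k + 1)).le
  rw [mul_pow, mul_pow]
  simp only [pow_succ] at *
  linarith

/-- At the critical value `t = 1 - 1 / (n - 1) ^ 2`, the tangent line passes through `(0, 1)`. -/
lemma tangent_at_zero (k : ℕ) {t : ℝ} (hkt : ((k : ℝ) + 1) ^ 2 * t = ((k : ℝ) + 1) ^ 2 - 1) :
    1 - ((k : ℝ) + 2) * t ^ (k + 1) + (k + 1) * t ^ (k + 2)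
        + (k + 2) * (k + 1) * t ^ k * (1 - t) * t = 1 := by
  simp only [pow_succ] at *
  linear_combination (-t * t ^ k) * hkt

/-- The cdf of the distribution on `{a, b}` putting mass `p` on `a`. -/
noncomputable def twoPointCdf (a b p : ℝ) (v : ℝ) : ℝ :=
  if v < a then 0 else if v < b then p else 1

namespace twoPointCdf

variable {a b p : ℝ}

lemma eq_zero {v : ℝ} (h : v < a) : twoPointCdf a b p v = 0 := if_pos h

lemma eq_mass {v : ℝ} (h : a ≤ v) (h' : v < b) : twoPointCdf a b p v = p := by
  simp [twoPointCdf, h.not_gt, h']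

lemma eq_one (hab : a ≤ b) {v : ℝ} (h : b ≤ v) : twoPointCdf a b p v = 1 := by
  simp [twoPointCdf, h.not_gt, (hab.trans h).not_gt]

lemma monotone (hp : 0 ≤ p) (hp1 : p ≤ 1) : Monotone (twoPointCdf a b p) := by
  intro x y hxy
  unfold twoPointCdf
  split_ifs <;> linarith

lemma continuousWithinAt_Ici (hab : a ≤ b) (x : ℝ) :
    ContinuousWithinAt (twoPointCdf a b p) (Ici x) x := by
  suffices h : ∀ᶠ y in nhdsWithin x (Ici x), twoPointCdf a b p y = twoPointCdf a b p x from
    tendsto_const_nhds.congr' (h.mono fun _ hy => hy.symm)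
  rcases lt_or_ge x a with hxa | hxa
  · filter_upwards [mem_nhdsWithin_of_mem_nhds (Iio_mem_nhds hxa)] with y hy
    rw [eq_zero hy, eq_zero hxa]
  rcases lt_or_ge x b with hxb | hxb
  · filter_upwards [mem_nhdsWithin_of_mem_nhds (Iio_mem_nhds hxb), self_mem_nhdsWithin]
      with y hy hxy
    rw [eq_mass (hxa.trans hxy) hy, eq_mass hxa hxb]
  · filter_upwards [self_mem_nhdsWithin] with y hxy
    rw [eq_one hab (hxb.trans hxy), eq_one hab hxb]

lemma integral_one_sub (ha : 0 ≤ a) (hab : a ≤ b) (hp : 0 ≤ p) (hp1 : p ≤ 1) :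
    ∫ v in (0 : ℝ)..b, (1 - twoPointCdf a b p v) = a + (b - a) * (1 - p) := by
  have hi : ∀ x y, IntervalIntegrable (fun v => 1 - twoPointCdf a b p v) volume x y := fun x y =>
    intervalIntegrable_const.sub (monotone hp hp1).intervalIntegrable
  rw [← intervalIntegral.integral_add_adjacent_intervals (hi 0 a) (hi a b)]
  congr 1
  · rw [intervalIntegral.integral_congr_Ioo_of_le (g := fun _ => (1 : ℝ)) ha]
    · simp
    · intro v hv
      simp [eq_zero hv.2]
  · rw [intervalIntegral.integral_congr_Ioo_of_le (g := fun _ => 1 - p) hab]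
    · simp [mul_sub]
    · intro v hv
      simp [eq_mass hv.1.le hv.2]

lemma delta1 {m : ℝ} (ha : 0 ≤ a) (ham : a < m) (hmb : m < b) :
    Delta1 m b (twoPointCdf a b ((b - m) / (b - a))) := by
  have hba : 0 < b - a := by linarith
  have hab : a ≤ b := by linarith
  have hp : 0 ≤ (b - m) / (b - a) := div_nonneg (by linarith) hba.le
  have hp1 : (b - m) / (b - a) ≤ 1 := (div_le_one hba).2 (by linarith)
  refine ⟨monotone hp hp1, continuousWithinAt_Ici hab, fun v hv => eq_zero (hv.trans_le ha),
    fun v hv => eq_one hab hv, ?_⟩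
  rw [integral_one_sub ha hab hp hp1]
  field_simp
  ring

end twoPointCdf

namespace Delta1

variable {m vbar : ℝ} {F G : ℝ → ℝ}

lemma nonneg (hF : Delta1 m vbar F) (v : ℝ) : 0 ≤ F v := by
  rw [← hF.2.2.1 (min v (-1)) (by simp)]
  exact hF.1 (min_le_left _ _)

lemma intervalIntegrable_pow (hF : Delta1 m vbar F) (j : ℕ) (x y : ℝ) :
    IntervalIntegrable (fun v => F v ^ j) volume x y := by
  have h : Monotone fun v => F v ^ j := fun u v huv => pow_le_pow_left₀ (hF.nonneg u) (hF.1 huv) j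
  exact h.intervalIntegrable

lemma revenue_self (hF : Delta1 m vbar F) {n : ℕ} {c : ℝ} (hc : c ≤ vbar) :
    revenue n c F c =
      c + ∫ v in c..vbar, (1 - (n : ℝ) * F v ^ (n - 1) + ((n : ℝ) - 1) * F v ^ n) := by
  rw [revenue, sub_self, zero_mul, sub_zero, intervalIntegral.integral_of_le hc,
    setIntegral_eq_of_subset_of_forall_sdiff_eq_zero measurableSet_Ioi Ioc_subset_Ioi_self]
  rintro v ⟨hv, hv'⟩
  have : vbar ≤ v := (not_le.1 fun h => hv' ⟨hv, h⟩).le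
  simp [hF.2.2.2.1 v this]

lemma intervalIntegrable (hF : Delta1 m vbar F) (x y : ℝ) : IntervalIntegrable F volume x y :=
  hF.1.intervalIntegrable

/-- Among cdfs with a given mean, one vanishing below `c` has the largest integral above `c`. -/
lemma integral_sub_nonpos (hF : Delta1 m vbar F) (hG : Delta1 m vbar G) {c : ℝ} (hc : 0 ≤ c)
    (hG0 : ∀ v < c, G v = 0) : ∫ v in c..vbar, (F v - G v) ≤ 0 := by
  have hi : ∀ x y, IntervalIntegrable (fun v => F v - G v) volume x y := fun x y =>
    (hF.intervalIntegrable x y).sub (hG.intervalIntegrable x y)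
  have htot : ∫ v in (0 : ℝ)..vbar, (F v - G v) = 0 := by
    have h : ∫ v in (0 : ℝ)..vbar, ((1 - G v) - (1 - F v)) = m - m := by
      rw [intervalIntegral.integral_sub
        (intervalIntegrable_const.sub (hG.intervalIntegrable _ _))
        (intervalIntegrable_const.sub (hF.intervalIntegrable _ _)), hG.2.2.2.2, hF.2.2.2.2]
    simpa using h
  have hlow : 0 ≤ ∫ v in (0 : ℝ)..c, (F v - G v) := by
    rw [intervalIntegral.integral_congr_Ioo_of_le (g := F) hc]
    · exact intervalIntegral.integral_nonneg hc fun v _ => hF.nonneg v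
    · intro v hv
      simp [hG0 v hv.2]
  have := intervalIntegral.integral_add_adjacent_intervals (hi 0 c) (hi c vbar)
  linarith

lemma revenue_twoPointCdf_le (hF : Delta1 m vbar F) {k : ℕ} {a c p : ℝ}
    (hG : Delta1 m vbar (twoPointCdf a vbar p)) (hc : 0 ≤ c) (hca : c ≤ a) (hav : a ≤ vbar)
    (hp : 0 < p) (hp1 : p ≤ 1) (hkp : ((k : ℝ) + 1) ^ 2 - 1 ≤ ((k : ℝ) + 1) ^ 2 * p)
    (h : a = c ∨ ((k : ℝ) + 1) ^ 2 * p = ((k : ℝ) + 1) ^ 2 - 1) :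
    revenue (k + 2) c (twoPointCdf a vbar p) c ≤ revenue (k + 2) c F c := by
  have hcv := hca.trans hav
  rw [hF.revenue_self hcv, hG.revenue_self hcv]
  set G := twoPointCdf a vbar p with hGdef
  set D : ℝ := (k + 2) * (k + 1) * p ^ k * (1 - p) with hD
  have hD0 : 0 ≤ D := by
    have := sub_nonneg.2 hp1
    positivity
  have hint : ∀ {H : ℝ → ℝ}, Delta1 m vbar H → IntervalIntegrable (fun v =>
      1 - ((k + 2 : ℕ) : ℝ) * H v ^ (k + 2 - 1) + (((k + 2 : ℕ) : ℝ) - 1) * H v ^ (k + 2))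
      volume c vbar := fun hH =>
    (intervalIntegrable_const.sub ((hH.intervalIntegrable_pow _ _ _).const_mul _)).add
      ((hH.intervalIntegrable_pow _ _ _).const_mul _)
  have hFG : IntervalIntegrable (fun v => D * (F v - G v)) volume c vbar :=
    ((hF.intervalIntegrable _ _).sub (hG.intervalIntegrable _ _)).const_mul _
  have hpt : ∀ v ∈ Ioo c vbar,
      1 - ((k + 2 : ℕ) : ℝ) * G v ^ (k + 2 - 1) + (((k + 2 : ℕ) : ℝ) - 1) * G v ^ (k + 2)
        - D * (F v - G v) ≤
      1 - ((k + 2 : ℕ) : ℝ) * F v ^ (k + 2 - 1) + (((k + 2 : ℕ) : ℝ) - 1) * F v ^ (k + 2) := by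
    intro v hv
    have e1 : k + 2 - 1 = k + 1 := rfl
    have e2 : ((k + 2 : ℕ) : ℝ) - 1 = k + 1 := by push_cast; ring
    have e3 : ((k + 2 : ℕ) : ℝ) = k + 2 := by push_cast; ring
    rw [e2, e3, e1]
    have htan := tangent_le_revenue_integrand k (hF.nonneg v) hp hkp
    rw [← hD] at htan
    rcases lt_or_ge v a with hva | hva
    · have h0 := tangent_at_zero k (h.resolve_left (by have := hv.1; intro; linarith))
      rw [← hD] at h0
      rw [hGdef, twoPointCdf.eq_zero hva, zero_pow (by omega), zero_pow (by omega)]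
      linarith
    · rwa [hGdef, twoPointCdf.eq_mass hva hv.2]
  have hmono := intervalIntegral.integral_mono_on_of_le_Ioo hcv ((hint hG).sub hFG) (hint hF) hpt
  rw [intervalIntegral.integral_sub (hint hG) hFG, intervalIntegral.integral_const_mul] at hmono
  have hneg := mul_nonneg hD0 (neg_nonneg.2
    (hF.integral_sub_nonpos hG hc fun v hv => twoPointCdf.eq_zero (hv.trans_le hca)))
  linarith

end Delta1

lemma vminStar_lt {n : ℕ} {m vbar : ℝ} (hn : 2 ≤ n) (hm : 0 < m) (hmv : m < vbar) :
    vminStar n m vbar < m := by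
  unfold vminStar
  split_ifs with h
  · exact hm
  · have hn3 : (3 : ℝ) ≤ n := by exact_mod_cast (by omega : 3 ≤ n)
    exact max_lt (sub_lt_self _ (div_pos (by linarith) (by nlinarith))) hm

theorem worst_case_distribution_delta1
    (n : ℕ) (hn : 2 ≤ n) (c m vbar : ℝ)
    (hc : 0 ≤ c) (hcm : c < m) (hmv : m < vbar) :
    let a : ℝ := max (vminStar n m vbar) c
    let Fstar : ℝ → ℝ := fun v =>
      if v < a then 0 else if v < vbar then (vbar - m) / (vbar - a) else 1
    Delta1 m vbar Fstar ∧
      ∀ F : ℝ → ℝ, Delta1 m vbar F → revenue n c Fstar c ≤ revenue n c F c := by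
  intro a Fstar
  have hca : c ≤ a := le_max_right _ _
  have ham : a < m := max_lt (vminStar_lt hn (hc.trans_lt hcm) hmv) hcm
  have hG : Delta1 m vbar Fstar := twoPointCdf.delta1 (hc.trans hca) ham hmv
  refine ⟨hG, fun F hF => ?_⟩
  have hva : 0 < vbar - a := by linarith
  obtain ⟨k, rfl⟩ := Nat.exists_eq_add_of_le' hn
  have key : ((k : ℝ) + 1) ^ 2 - 1 ≤ ((k : ℝ) + 1) ^ 2 * ((vbar - m) / (vbar - a)) ∧
      (a = c ∨ ((k : ℝ) + 1) ^ 2 * ((vbar - m) / (vbar - a)) = ((k : ℝ) + 1) ^ 2 - 1) := by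
    rw [← mul_div_assoc, le_div_iff₀ hva, div_eq_iff hva.ne']
    rcases Nat.eq_zero_or_pos k with rfl | hk
    · have hac : a = c := by simp [a, vminStar, hc]
      refine ⟨?_, Or.inl hac⟩
      norm_num
      linarith
    · have hk0 : (0 : ℝ) < k := by exact_mod_cast hk
      have hN : 0 < ((k : ℝ) + 1) ^ 2 - 1 := by nlinarith
      set a₀ : ℝ := m - (vbar - m) / (((k : ℝ) + 1) ^ 2 - 1) with ha₀
      have haa : a = max a₀ c := by
        have e : ((k + 2 : ℕ) : ℝ) - 1 = k + 1 := by push_cast; ring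
        simp only [a, vminStar]
        rw [if_neg (by omega), e, max_assoc, max_eq_right hc]
      have hcrit : (((k : ℝ) + 1) ^ 2 - 1) * (vbar - a₀) = ((k : ℝ) + 1) ^ 2 * (vbar - m) := by
        rw [ha₀]
        field_simp
        ring
      constructor
      · rw [← hcrit]
        exact mul_le_mul_of_nonneg_left (sub_le_sub_left (haa ▸ le_max_left _ _) _) hN.le
      · rcases max_choice a₀ c with h | h
        · exact Or.inr (by rw [haa, h, hcrit])
        · exact Or.inl (haa.trans h)
  exact hF.revenue_twoPointCdf_le hG hc hca (ham.trans hmv).le (div_pos (by linarith) hva)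
    ((div_le_one hva).2 (by linarith)) key.1 key.2
end

section
/- Let r ∈ [vmin**, m). Suppose λ₁ < 0, λ₂ > 0 and q ∈ [q*_n, 1) satisfy: (i) λ₁ + 2λ₂·r = n(n−1)·z(q); (ii) n(n−1)·∫_q^1 (z(y) − z(q)) dy = 2λ₂·(m − r); (iii) n²(n−1)²·∫_q^1 (z(y) − z(q))² dy = 4λ₂²·((m − r)² + σ²). Define the cdf G_r by G_r(v) := 0 for v < r, and for v ≥ r: G_r(v) := 1 if λ₁ + 2λ₂v ≥ 0, and otherwise G_r(v) := the unique y ∈ [q, 1) with n(n−1)·z(y) = λ₁ + 2λ₂v. Then the expected revenue of the second-price auction with reserve r against G_r admits the closed form R(G_r, r) = −λ₁·(m − q·r) − 2λ₂·(m² + σ² − q·r²) − n·z(q)·r·q + c·qⁿ. -/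
open MeasureTheory Set Filter

/-- `z(y) = y^{n-1} - y^{n-2}`. -/
noncomputable def zfun (n : ℕ) (y : ℝ) : ℝ := y ^ (n - 1) - y ^ (n - 2)

/-- `q*_n = 1 - 1/(n-1)²`. -/
noncomputable def qstar (n : ℕ) : ℝ := 1 - 1 / ((n : ℝ) - 1) ^ 2

/-- `φ(q)` from the construction of the worst-case distributions. -/
noncomputable def phi (n : ℕ) (q : ℝ) : ℝ :=
  (∫ y in q..1, (zfun n y - zfun n q) ^ 2) / (∫ y in q..1, (zfun n y - zfun n q)) ^ 2

/-- The lowest point `vmin**` of the support of the worst-case distribution. -/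
noncomputable def vminSS (n : ℕ) (m σ : ℝ) : ℝ :=
  max (m - σ / Real.sqrt (phi n (qstar n) - 1)) 0

/-- The lower bound `q*_n` exceeds the critical point `(n-2)/(n-1)` of `z`. -/
lemma critical_le_qstar (k : ℕ) : (k : ℝ) ≤ ((k : ℝ) + 1) * qstar (k + 2) := by
  have hk : (0 : ℝ) < (k : ℝ) + 1 := by positivity
  have h : ((k : ℝ) + 1) * qstar (k + 2) = (k : ℝ) + (1 - 1 / ((k : ℝ) + 1)) := by
    unfold qstar
    push_cast
    rw [show (k : ℝ) + 2 - 1 = (k : ℝ) + 1 by ring]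
    field_simp
    ring
  have h1 : 1 / ((k : ℝ) + 1) ≤ 1 := by
    rw [div_le_one hk]
    linarith [(Nat.cast_nonneg k : (0 : ℝ) ≤ k)]
  linarith

lemma zfun_add_two (k : ℕ) (y : ℝ) : zfun (k + 2) y = y ^ (k + 1) - y ^ k := rfl

lemma hasDerivAt_zfun (k : ℕ) (y : ℝ) :
    HasDerivAt (zfun (k + 2)) (((k : ℝ) + 1) * y ^ k - k * y ^ (k - 1)) y := by
  have h := (hasDerivAt_pow (k + 1) y).sub (hasDerivAt_pow k y)
  refine h.congr_deriv ?_
  push_cast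
  simp

lemma continuous_zfun (n : ℕ) : Continuous (zfun n) := by
  unfold zfun
  fun_prop

lemma strictMonoOn_zfun (k : ℕ) {q : ℝ} (hq : qstar (k + 2) ≤ q) :
    StrictMonoOn (zfun (k + 2)) (Ici q) := by
  refine strictMonoOn_of_deriv_pos (convex_Ici q) (continuous_zfun _).continuousOn ?_
  intro y hy
  rw [interior_Ici, mem_Ioi] at hy
  rw [(hasDerivAt_zfun k y).deriv]
  have hcrit := critical_le_qstar k
  have hy' : (k : ℝ) < ((k : ℝ) + 1) * y :=
    hcrit.trans_lt (mul_lt_mul_of_pos_left (hq.trans_lt hy) (by positivity))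
  have hy0 : 0 < y := by
    have : (0 : ℝ) ≤ k := Nat.cast_nonneg k
    exact pos_of_mul_pos_right (this.trans_lt hy') (by positivity)
  rcases k with _ | j
  · simp
  · have : ((j + 1 : ℕ) + 1 : ℝ) * y ^ (j + 1) - (j + 1 : ℕ) * y ^ (j + 1 - 1)
        = y ^ j * (((j + 1 : ℕ) + 1 : ℝ) * y - (j + 1 : ℕ)) := by
      simp only [Nat.add_sub_cancel, pow_succ]
      ring
    rw [this]
    exact mul_pos (by positivity) (by linarith)

/-- The revenue integrand is an antiderivative of `n(n-1)z`. -/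
lemma hasDerivAt_revenue_integrand (k : ℕ) (y : ℝ) :
    HasDerivAt (fun y : ℝ => 1 - ((k : ℝ) + 2) * y ^ (k + 1) + ((k : ℝ) + 1) * y ^ (k + 2))
      (((k : ℝ) + 2) * ((k : ℝ) + 1) * zfun (k + 2) y) y := by
  have h := (((hasDerivAt_pow (k + 1) y).const_mul ((k : ℝ) + 2)).const_sub 1).add
    ((hasDerivAt_pow (k + 2) y).const_mul ((k : ℝ) + 1))
  refine h.congr_deriv ?_
  rw [zfun_add_two]
  push_cast
  ring

theorem revenue_closed_form_G
    (n : ℕ) (hn : 2 ≤ n) (c m σ : ℝ)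
    (hc : 0 ≤ c) (hcm : c < m) (hσ : 0 < σ)
    (r : ℝ) (hr : r ∈ Set.Ico (vminSS n m σ) m)
    (l1 l2 q : ℝ) (hl1 : l1 < 0) (hl2 : 0 < l2) (hq : q ∈ Set.Ico (qstar n) 1)
    (heq1 : l1 + 2 * l2 * r = (n : ℝ) * ((n : ℝ) - 1) * zfun n q)
    (heq2 : (n : ℝ) * ((n : ℝ) - 1) * (∫ y in q..1, (zfun n y - zfun n q)) =
      2 * l2 * (m - r))
    (heq3 : (n : ℝ) ^ 2 * ((n : ℝ) - 1) ^ 2 *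
        (∫ y in q..1, (zfun n y - zfun n q) ^ 2) =
      4 * l2 ^ 2 * ((m - r) ^ 2 + σ ^ 2))
    (G : ℝ → ℝ)
    (hG0 : ∀ v < r, G v = 0)
    (hG1 : ∀ v ≥ r, 0 ≤ l1 + 2 * l2 * v → G v = 1)
    (hG2 : ∀ v ≥ r, l1 + 2 * l2 * v < 0 →
      G v ∈ Set.Ico q 1 ∧ (n : ℝ) * ((n : ℝ) - 1) * zfun n (G v) = l1 + 2 * l2 * v) :
    revenue n c G r =
      -l1 * (m - q * r) - 2 * l2 * (m ^ 2 + σ ^ 2 - q * r ^ 2) -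
        (n : ℝ) * zfun n q * r * q + c * q ^ n := by
  obtain ⟨k, rfl⟩ : ∃ k, n = k + 2 := ⟨n - 2, by omega⟩
  have hcast : ((k + 2 : ℕ) : ℝ) = (k : ℝ) + 2 := by push_cast; ring
  have hcast' : (k : ℝ) + 2 - 1 = (k : ℝ) + 1 := by ring
  rw [hcast, hcast'] at heq1 heq2 heq3 hG2
  obtain ⟨hqs, hq1⟩ := hq
  have hmono := strictMonoOn_zfun k hqs
  have hz1 : zfun (k + 2) 1 = 0 := by simp [zfun]
  set N : ℝ := ((k : ℝ) + 2) * ((k : ℝ) + 1) with hN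
  have hNpos : 0 < N := by positivity
  have hneg : ∀ y ∈ Ico q 1, zfun (k + 2) y < 0 := fun y hy => by
    rw [← hz1]
    exact hmono hy.1 hq1.le hy.2
  have hrneg : l1 + 2 * l2 * r < 0 := by
    rw [heq1]
    exact mul_neg_of_pos_of_neg hNpos (hneg q ⟨le_rfl, hq1⟩)
  have hGr : G r = q := by
    obtain ⟨hmem, he⟩ := hG2 r le_rfl hrneg
    refine hmono.injOn hmem.1 self_mem_Ici ?_
    rw [heq1] at he
    exact mul_left_cancel₀ hNpos.ne' he
  -- The quantile function of `G` on `[q, 1)`.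
  set V : ℝ → ℝ := fun y => (N * zfun (k + 2) y - l1) / (2 * l2) with hV
  have hVeq : ∀ y, l1 + 2 * l2 * V y = N * zfun (k + 2) y := fun y => by
    simp only [hV]
    field_simp
    ring
  have hVq : V q = r := by
    have := hVeq q
    rw [← heq1] at this
    exact mul_left_cancel₀ (by positivity : 2 * l2 ≠ 0) (by linarith)
  have hVmono : StrictMonoOn V (Ici q) := fun a ha b hb hab => by
    have h1 := mul_lt_mul_of_pos_left (hmono ha hb hab) hNpos
    simp only [hV]
    gcongr
  have hVr : ∀ y ∈ Ico q 1, r ≤ V y := fun y hy => by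
    rw [← hVq]
    exact hVmono.monotoneOn self_mem_Ici hy.1 hy.1
  have hVneg : ∀ y ∈ Ico q 1, l1 + 2 * l2 * V y < 0 := fun y hy => by
    rw [hVeq]
    exact mul_neg_of_pos_of_neg hNpos (hneg y hy)
  have hGV : ∀ y ∈ Ico q 1, G (V y) = y := fun y hy => by
    obtain ⟨hmem, he⟩ := hG2 (V y) (hVr y hy) (hVneg y hy)
    rw [hVeq] at he
    exact hmono.injOn hmem.1 hy.1 (mul_left_cancel₀ hNpos.ne' he)
  have himage : V '' Ico q 1 = {v | r ≤ v ∧ l1 + 2 * l2 * v < 0} := by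
    ext v
    constructor
    · rintro ⟨y, hy, rfl⟩
      exact ⟨hVr y hy, hVneg y hy⟩
    · rintro ⟨hrv, hv⟩
      obtain ⟨hmem, he⟩ := hG2 v hrv hv
      refine ⟨G v, hmem, mul_left_cancel₀ (by positivity : 2 * l2 ≠ 0) ?_⟩
      linarith [hVeq (G v)]
  set h : ℝ → ℝ :=
    fun y => 1 - ((k : ℝ) + 2) * y ^ (k + 1) + ((k : ℝ) + 1) * y ^ (k + 2) with hh
  have hh1 : h 1 = 0 := by simp only [hh, one_pow]; ring
  set V' : ℝ → ℝ :=
    fun y => N * (((k : ℝ) + 1) * y ^ k - k * y ^ (k - 1)) / (2 * l2) with hV'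
  have hVderiv : ∀ y, HasDerivAt V (V' y) y := fun y =>
    (((hasDerivAt_zfun k y).const_mul N).sub_const l1).div_const (2 * l2)
  have hchange : ∫ v in Ioi r, h (G v) = ∫ y in q..1, h y * V' y := by
    rw [← integral_Ici_eq_integral_Ioi]
    have hsub : V '' Ico q 1 ⊆ Ici r := by
      rintro _ ⟨y, hy, rfl⟩
      exact hVr y hy
    rw [setIntegral_eq_of_subset_of_forall_sdiff_eq_zero measurableSet_Ici hsub,
      integral_image_eq_integral_deriv_smul_of_monotoneOn measurableSet_Ico
        (fun y _ => (hVderiv y).hasDerivWithinAt)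
        (hVmono.monotoneOn.mono Ico_subset_Ici_self),
      intervalIntegral.integral_of_le hq1.le, ← integral_Ico_eq_integral_Ioc]
    · refine setIntegral_congr_fun measurableSet_Ico fun y hy => ?_
      simp only [hGV y hy, smul_eq_mul, mul_comm]
    · rintro v ⟨hrv, hv⟩
      rw [himage] at hv
      rw [hG1 v hrv (not_lt.1 fun hlt => hv ⟨hrv, hlt⟩), hh1]
  have hzc := continuous_zfun (k + 2)
  have hparts : ∫ y in q..1, h y * V' y =
      h 1 * V 1 - h q * V q - ∫ y in q..1, N * zfun (k + 2) y * V y :=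
    intervalIntegral.integral_mul_deriv_eq_deriv_mul
      (fun y _ => hasDerivAt_revenue_integrand k y) (fun y _ => hVderiv y)
      ((continuous_const.mul hzc).intervalIntegrable _ _)
      ((by fun_prop : Continuous V').intervalIntegrable _ _)
  set A := ∫ y in q..1, zfun (k + 2) y with hA
  set B := ∫ y in q..1, zfun (k + 2) y ^ 2 with hB
  have hiz : IntervalIntegrable (zfun (k + 2)) volume q 1 := hzc.intervalIntegrable _ _
  have hiz2 : IntervalIntegrable (fun y => zfun (k + 2) y ^ 2) volume q 1 :=
    (hzc.pow 2).intervalIntegrable _ _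
  have hI1 : ∫ y in q..1, (zfun (k + 2) y - zfun (k + 2) q) =
      A - (1 - q) * zfun (k + 2) q := by
    rw [intervalIntegral.integral_sub hiz intervalIntegrable_const]
    simp [hA]
  have hI2 : ∫ y in q..1, (zfun (k + 2) y - zfun (k + 2) q) ^ 2 =
      B - 2 * zfun (k + 2) q * A + (1 - q) * zfun (k + 2) q ^ 2 := by
    have : ∀ y, (zfun (k + 2) y - zfun (k + 2) q) ^ 2 =
        zfun (k + 2) y ^ 2 - 2 * zfun (k + 2) q * zfun (k + 2) y + zfun (k + 2) q ^ 2 :=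
      fun y => by ring
    simp only [this]
    rw [intervalIntegral.integral_add (hiz2.sub (hiz.const_mul _)) intervalIntegrable_const,
      intervalIntegral.integral_sub hiz2 (hiz.const_mul _), intervalIntegral.integral_const_mul]
    simp [hA, hB]
  have hI3 : ∫ y in q..1, N * zfun (k + 2) y * V y = (N ^ 2 * B - l1 * (N * A)) / (2 * l2) := by
    have : ∀ y, N * zfun (k + 2) y * V y =
        N ^ 2 / (2 * l2) * zfun (k + 2) y ^ 2 - l1 * N / (2 * l2) * zfun (k + 2) y :=
      fun y => by simp only [hV]; ring
    simp only [this]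
    rw [intervalIntegral.integral_sub (hiz2.const_mul _) (hiz.const_mul _),
      intervalIntegral.integral_const_mul, intervalIntegral.integral_const_mul]
    ring
  rw [hI1] at heq2
  rw [hI2, ← mul_pow, ← hN] at heq3
  have hNA : N * A = 2 * l2 * (m - r) + (1 - q) * (l1 + 2 * l2 * r) := by
    rw [heq1]
    linarith
  have hNB : N ^ 2 * B = 4 * l2 ^ 2 * ((m - r) ^ 2 + σ ^ 2)
      + 2 * (l1 + 2 * l2 * r) * (N * A) - (1 - q) * (l1 + 2 * l2 * r) ^ 2 := by
    rw [heq1]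
    linarith
  have hI : (N ^ 2 * B - l1 * (N * A)) / (2 * l2) =
      2 * l2 * (m ^ 2 + σ ^ 2 - q * r ^ 2) + l1 * (m - q * r) := by
    rw [hNB, hNA, div_eq_iff (by positivity)]
    ring
  have hrev : revenue (k + 2) c G r = r - (r - c) * q ^ (k + 2) + ∫ v in Ioi r, h (G v) := by
    simp only [revenue, hGr, hh, hcast, hcast',
      show k + 2 - 1 = k + 1 from rfl]
  rw [hrev, hchange, hparts, hI3, hI, hh1, hVq, hcast, zfun_add_two]
  simp only [hh]
  ring
end
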